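/- For p ∈ (0,1/2) and q = 1-2p, the largest root of P_q(X) = X³ - ((1+5q)/2)X² + ((3q²+4q-1)/2)X - (q³+9q²-q-1)/8 is 1 - ((5-r)/3)p, where r = 2√7·cos(π/3 - arctan(3√3)/3). -/

import Mathlib

open Real

/-- The largest root of
`P_q(X) = X³ - ((1+5q)/2)X² + ((3q²+4q-1)/2)X - (q³+9q²-q-1)/8`, for
`q = 1-2p`, `p ∈ (0,1/2)`, is `1 - ((5-r)/3)p` where
`r = 2√7·cos(π/3 - arctan(3√3)/3)`. -/
theorem stmt2 (p q r : ℝ) (hp : p ∈ Set.Ioo (0:ℝ) (1/2)) (hq : q = 1 - 2*p)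
    (hr : r = 2 * Real.sqrt 7 * Real.cos (π/3 - Real.arctan (3 * Real.sqrt 3) / 3))
    (P : ℝ → ℝ)
    (hP : ∀ X : ℝ, P X =
      X^3 - ((1 + 5*q)/2) * X^2 + ((3*q^2 + 4*q - 1)/2) * X
        - (q^3 + 9*q^2 - q - 1)/8) :
    P (1 - ((5 - r)/3) * p) = 0 ∧
    ∀ x : ℝ, P x = 0 → x ≤ 1 - ((5 - r)/3) * p := by
  obtain ⟨hp0, hp1⟩ := hp
  have h7 : Real.sqrt 7 ^ 2 = 7 := Real.sq_sqrt (by norm_num)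
  have h7p : 0 < Real.sqrt 7 := Real.sqrt_pos.mpr (by norm_num)
  have h3 : Real.sqrt 3 ^ 2 = 3 := Real.sq_sqrt (by norm_num)
  have h3p : 0 < Real.sqrt 3 := Real.sqrt_pos.mpr (by norm_num)
  set a := Real.arctan (3 * Real.sqrt 3) with ha
  have hcosa : Real.cos a = 1 / (2 * Real.sqrt 7) := by
    rw [ha, Real.cos_arctan]
    congr 1
    rw [show 1 + (3 * Real.sqrt 3) ^ 2 = (2 * Real.sqrt 7) ^ 2 by
      rw [mul_pow, mul_pow, h3, h7]; norm_num]
    exact Real.sqrt_sq (by positivity)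
  have ha0 : 0 < a := Real.arctan_pos.mpr (by positivity)
  have ha1 : a < π / 2 := Real.arctan_lt_pi_div_two _
  have hpi := Real.pi_pos
  have hc : 1 / 2 < Real.cos (π / 3 - a / 3) := by
    rw [← Real.cos_pi_div_three]
    exact Real.cos_lt_cos_of_nonneg_of_le_pi (by linarith) (by linarith) (by linarith)
  have h3c : 4 * Real.cos (π / 3 - a / 3) ^ 3 - 3 * Real.cos (π / 3 - a / 3)
      = -(1 / (2 * Real.sqrt 7)) := by
    rw [← Real.cos_three_mul, ← hcosa, ← Real.cos_pi_sub]
    congr 1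
    ring
  set c := Real.cos (π / 3 - a / 3) with hcdef
  have hrgt : Real.sqrt 7 < r := by rw [hr]; nlinarith
  have hr3 : r ^ 3 - 21 * r + 7 = 0 := by
    have e : Real.sqrt 7 * (4 * c ^ 3 - 3 * c) = -(1 / 2) := by
      rw [h3c]; field_simp
    have e3 : Real.sqrt 7 ^ 3 = 7 * Real.sqrt 7 := by rw [pow_succ, h7]
    rw [hr, mul_pow, mul_pow, e3]
    linear_combination 14 * e
  have key : ∀ s : ℝ, P (1 - ((5 - s) / 3) * p) = p ^ 3 / 27 * (s ^ 3 - 21 * s + 7) := by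
    intro s
    rw [hP, hq]
    ring
  refine ⟨by rw [key, hr3, mul_zero], ?_⟩
  intro x hx
  by_contra! hlt
  obtain ⟨s, hs⟩ : ∃ s : ℝ, x = 1 - ((5 - s) / 3) * p :=
    ⟨5 - 3 * (1 - x) / p, by field_simp; ring⟩
  rw [hs, key] at hx
  have hs3 : s ^ 3 - 21 * s + 7 = 0 := by
    rcases mul_eq_zero.mp hx with h | h
    · exact absurd h (by positivity)
    · exact h
  have hrs : r < s := by
    rw [hs] at hlt
    by_contra! h
    nlinarith
  have hf : (s - r) * (s ^ 2 + s * r + r ^ 2 - 21) = 0 := by linear_combination hs3 - hr3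
  have hpos : 0 < s ^ 2 + s * r + r ^ 2 - 21 := by nlinarith
  exact absurd hf (mul_pos (by linarith) hpos).ne'
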